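/- Let A be a unital C*-algebra and let B and C be closed unital *-subalgebras of A such that every element of B commutes with every element of C (Einstein causality) and such that the Schlieder property holds: for all b ∈ B and c ∈ C, bc = 0 implies b = 0 or c = 0. Then for any b₁,…,bₙ ∈ B that are linearly independent over ℂ and any c₁,…,cₙ ∈ C with Σᵢ bᵢcᵢ = 0 in A, all cᵢ = 0; equivalently, the linear map from the algebraic tensor product B ⊗_ℂ C to A determined by b ⊗ c ↦ bc is injective, and hence induces an algebra isomorphism of B ⊗_ℂ C onto the subalgebra of A generated by B ∪ C. -/

import Mathlib

open scoped TensorProduct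

/-- Localisation near a point for finitely many continuous functions. -/
lemma roos_local_cont {X : Type*} [TopologicalSpace X] [CompactSpace X]
    {ι : Type*} [Fintype ι] (β : ι → C(X, ℂ)) (x : X) (ε : ℝ) (hε : 0 < ε) :
    ∃ e f : C(X, ℂ), f ≠ 0 ∧ e * f = f ∧
      ∀ i, ‖e * (β i - algebraMap ℂ C(X, ℂ) (β i x))‖ ≤ ε := by
  have hu : Continuous fun y => ∑ i, ‖β i y - β i x‖ := by fun_prop
  set u : X → ℝ := fun y => ∑ i, ‖β i y - β i x‖ with hudef
  have hux : u x = 0 := by simp [hudef]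
  refine ⟨⟨fun y => ((max 0 (min 1 (2 - 2 * u y / ε)) : ℝ) : ℂ), by fun_prop⟩,
    ⟨fun y => ((max 0 (1 - 2 * u y / ε) : ℝ) : ℂ), by fun_prop⟩, ?_, ?_, ?_⟩
  · intro h
    have := congrArg (fun g : C(X, ℂ) => g x) h
    simp [hux] at this
  · ext y
    simp only [ContinuousMap.mul_apply, ContinuousMap.coe_mk]
    rw [← Complex.ofReal_mul]
    congr 1
    rcases le_total (1 - 2 * u y / ε) 0 with h | h
    · simp [max_eq_left h]
    · rw [min_eq_left (by linarith), max_eq_right (zero_le_one' ℝ), one_mul]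
  · intro i
    rw [ContinuousMap.norm_le _ hε.le]
    intro y
    have h1 : ‖β i y - β i x‖ ≤ u y :=
      Finset.single_le_sum (f := fun i => ‖β i y - β i x‖) (fun _ _ => norm_nonneg _)
        (Finset.mem_univ i)
    simp only [ContinuousMap.mul_apply, ContinuousMap.coe_mk, ContinuousMap.sub_apply, norm_mul,
      algebraMap_apply, Complex.norm_real, Real.norm_eq_abs, smul_eq_mul, mul_one]
    rw [abs_of_nonneg (le_max_left _ _)]
    rcases le_total ε (u y) with h | h
    · have h2 : 2 ≤ 2 * u y / ε := by rw [le_div_iff₀ hε]; linarith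
      rw [max_eq_left ((min_le_right _ _).trans (by linarith))]
      simp [hε.le]
    · calc _ ≤ 1 * ε := by
            gcongr
            · exact max_le zero_le_one (min_le_left _ _)
            · exact h1.trans h
        _ = ε := one_mul _

lemma roos_local_comm {D : Type*} [CommCStarAlgebra D] {ι : Type*} [Fintype ι]
    (d : ι → D) (j : ι) (hj : d j ≠ 0) :
    ∃ l : ι → ℂ, l j ≠ 0 ∧ ∀ ε : ℝ, 0 < ε → ∃ e f : D, f ≠ 0 ∧ e * f = f ∧
      ∀ i, ‖e * (d i - algebraMap ℂ D (l i))‖ ≤ ε := by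
  let G := gelfandStarTransform D
  have hG : ∀ a, ‖G a‖ = ‖a‖ := fun a =>
    (gelfandTransform_isometry D).norm_map_of_map_zero (map_zero _) a
  have h0 : G (d j) ≠ 0 := by simpa using hj
  obtain ⟨x, hx⟩ : ∃ x, G (d j) x ≠ 0 := by
    by_contra! h
    exact h0 (ContinuousMap.ext h)
  refine ⟨fun i => G (d i) x, hx, fun ε hε => ?_⟩
  obtain ⟨e, f, hf, hef, h⟩ := roos_local_cont (fun i => G (d i)) x ε hε
  refine ⟨G.symm e, G.symm f, by simpa using hf, by rw [← map_mul, hef], fun i => ?_⟩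
  rw [← hG]
  have ha : ∀ z : ℂ, G (algebraMap ℂ D z) = algebraMap ℂ _ z := fun z =>
    (WeakDual.gelfandTransform ℂ D).commutes z
  rw [map_mul, map_sub, ha, StarAlgEquiv.apply_symm_apply]
  exact h i

lemma roos_local {A : Type*} [CStarAlgebra A] (S : StarSubalgebra ℂ A)
    (hS : IsClosed (S : Set A)) {ι : Type*} [Fintype ι] (d : ι → A) (hd : ∀ i, d i ∈ S)
    (h1 : ∀ i k, d i * d k = d k * d i) (h2 : ∀ i k, d i * star (d k) = star (d k) * d i)
    (j : ι) (hj : d j ≠ 0) :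
    ∃ l : ι → ℂ, l j ≠ 0 ∧ ∀ ε : ℝ, 0 < ε → ∃ e ∈ S, ∃ f ∈ S, f ≠ 0 ∧ e * f = f ∧
      ∀ i, ‖e * (d i - algebraMap ℂ A (l i))‖ ≤ ε := by
  have hc := StarAlgebra.isMulCommutative_adjoin ℂ (s := Set.range d)
    (by rintro _ ⟨i, rfl⟩ _ ⟨k, rfl⟩; exact h1 i k)
    (by rintro _ ⟨i, rfl⟩ _ ⟨k, rfl⟩; exact h2 i k)
  let D := (StarAlgebra.adjoin ℂ (Set.range d)).topologicalClosure
  have hDc : IsClosed (D : Set A) := isClosed_closure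
  have hDS : D ≤ S := StarSubalgebra.topologicalClosure_minimal
    (StarAlgebra.adjoin_le (by rintro _ ⟨i, rfl⟩; exact hd i)) hS
  have hdD : ∀ i, d i ∈ D := fun i =>
    StarSubalgebra.le_topologicalClosure _ (StarAlgebra.subset_adjoin ℂ _ ⟨i, rfl⟩)
  have hmc : ∀ x y : D, x * y = y * x :=
    (StarSubalgebra.commRingTopologicalClosure (StarAlgebra.adjoin ℂ (Set.range d))
      (fun x y => hc.is_comm.comm x y)).mul_comm
  let _ : CommCStarAlgebra D :=
    { StarSubalgebra.cstarAlgebra D (h_closed := hDc) with mul_comm := hmc }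
  obtain ⟨l, hl, h⟩ := roos_local_comm (D := D) (fun i => ⟨d i, hdD i⟩) j
    (fun h => hj (congrArg Subtype.val h))
  refine ⟨l, hl, fun ε hε => ?_⟩
  obtain ⟨e, f, hf, hef, h⟩ := h ε hε
  exact ⟨e, hDS e.2, f, hDS f.2, fun h => hf (Subtype.ext h), congrArg Subtype.val hef, h⟩

lemma roos_main {A : Type*} [CStarAlgebra A] (B C : StarSubalgebra ℂ A)
    (hB : IsClosed (B : Set A)) (hC : IsClosed (C : Set A))
    (hcomm : ∀ b ∈ B, ∀ c ∈ C, b * c = c * b)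
    (hS : ∀ b ∈ B, ∀ c ∈ C, b * c = 0 → b = 0 ∨ c = 0) (n : ℕ) :
    ∀ (b c : Fin n → A), (∀ i, b i ∈ B) → (∀ i, c i ∈ C) → LinearIndependent ℂ b →
      ∑ i, b i * c i = 0 → ∀ i, c i = 0 := by
  induction n with
  | zero => intro b c _ _ _ _ i; exact i.elim0
  | succ n ih =>
    intro b c hb hc hli hsum j
    by_contra hj
    have key : ∀ x ∈ C, ∀ k, c j * x * c k = c k * x * c j := by
      intro x hx k
      have hs : ∑ i, b i * (c j * x * c i - c i * x * c j) = 0 := by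
        have e1 : ∑ i, b i * (c j * x * c i) = c j * x * ∑ i, b i * c i := by
          rw [Finset.mul_sum]
          refine Finset.sum_congr rfl fun i _ => ?_
          rw [← mul_assoc, hcomm _ (hb i) _ (mul_mem (hc j) hx), mul_assoc]
        have e2 : ∑ i, b i * (c i * x * c j) = (∑ i, b i * c i) * (x * c j) := by
          rw [Finset.sum_mul]
          exact Finset.sum_congr rfl fun i _ => by simp only [mul_assoc]
        simp only [mul_sub, Finset.sum_sub_distrib, e1, e2, hsum, mul_zero, zero_mul, sub_zero]
      rw [Fin.sum_univ_succAbove _ j, sub_self, mul_zero, zero_add] at hs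
      have := ih (fun i => b (j.succAbove i)) _ (fun i => hb _)
        (fun i => sub_mem (mul_mem (mul_mem (hc j) hx) (hc (j.succAbove i)))
          (mul_mem (mul_mem (hc (j.succAbove i)) hx) (hc j)))
        (hli.comp _ Fin.succAbove_right_injective) hs
      rcases Fin.eq_self_or_eq_succAbove j k with rfl | ⟨i, rfl⟩
      · rfl
      · exact sub_eq_zero.mp (this i)
    set a := star (c j) * c j with ha
    have haC : a ∈ C := mul_mem (star_mem (hc j)) (hc j)
    have has : star a = a := by simp [ha]
    have ha0 : a ≠ 0 := by simpa [ha] using hj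
    let p : Fin (n + 1) → A := fun k => star (c j) * c k
    have hpC : ∀ k, p k ∈ C := fun k => mul_mem (star_mem (hc j)) (hc k)
    have hp : ∀ x ∈ C, ∀ k, a * x * p k = p k * x * a := by
      intro x hx k
      have := key (x * star (c j)) (mul_mem hx (star_mem (hc j))) k
      calc a * x * p k = star (c j) * (c j * (x * star (c j)) * c k) := by
            simp only [ha, p, mul_assoc]
        _ = p k * x * a := by rw [this]; simp only [ha, p, mul_assoc]
    have hap : ∀ k, a * p k = p k * a := fun k => by simpa using hp 1 (one_mem _) k
    have haps : ∀ k, a * star (p k) = star (p k) * a := fun k => by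
      have := congrArg star (hap k)
      simpa [has] using this.symm
    have hpp : ∀ x ∈ C, a * x = x * a → ∀ k, a * (x * p k) = a * (p k * x) := by
      intro x hx hax k
      rw [← mul_assoc, hp x hx k, mul_assoc, ← hax, ← mul_assoc, ← hap, mul_assoc]
    have hgen : ∀ x ∈ C, a * x = x * a → ∀ k, (a * p k) * (a * x) = (a * x) * (a * p k) := by
      intro x hx hax k
      calc (a * p k) * (a * x) = a * ((p k * a) * x) := by simp only [mul_assoc]
        _ = a * (a * (p k * x)) := by rw [← hap]; simp only [mul_assoc]
        _ = a * ((a * x) * p k) := by rw [← hpp x hx hax k]; simp only [mul_assoc]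
        _ = (a * x) * (a * p k) := by rw [hax]; simp only [← mul_assoc]; rw [hax]
    obtain ⟨l, hl, hloc⟩ := roos_local C hC (fun k => a * p k)
      (fun k => mul_mem haC (hpC k))
      (fun i k => hgen (p k) (hpC k) (hap k) i)
      (fun i k => by
        have : star (a * p k) = a * star (p k) := by rw [star_mul, has, haps]
        rw [this]
        exact hgen (star (p k)) (star_mem (hpC k)) (haps k) i) j
      (by
        change a * a ≠ 0
        intro h
        apply ha0
        rw [← CStarRing.star_mul_self_eq_zero_iff, has, h])
    have hsum2 : ∑ i, b i * (a * p i) = 0 := by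
      have : ∑ i, b i * (a * p i) = a * star (c j) * ∑ i, b i * c i := by
        rw [Finset.mul_sum]
        refine Finset.sum_congr rfl fun i _ => ?_
        rw [← mul_assoc (a * star (c j)), ← hcomm _ (hb i) _ (mul_mem haC (star_mem (hc j)))]
        simp only [p, mul_assoc]
      rw [this, hsum, mul_zero]
    set b' := ∑ i, l i • b i with hb'
    have hb'B : b' ∈ B := sum_mem fun i _ => SMulMemClass.smul_mem _ (hb i)
    have hb'0 : b' ≠ 0 := fun h => hl (Fintype.linearIndependent_iff.mp hli l h j)
    set h := b' * star b' with hh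
    have hhB : h ∈ B := mul_mem hb'B (star_mem hb'B)
    have hh0 : h ≠ 0 := by simpa [hh] using hb'0
    have hhs : star h = h := by simp [hh]
    obtain ⟨m, hm, hlocB⟩ := roos_local B hB (fun _ : Unit => h) (fun _ => hhB)
      (fun _ _ => rfl) (fun _ _ => by simp [hhs]) () hh0
    set M := m () with hM
    have hMpos : 0 < ‖M‖ := norm_pos_iff.mpr hm
    obtain ⟨q, hqB, g, hgB, hg0, hqg, hq⟩ := hlocB (‖M‖ / 2) (by positivity)
    replace hq := hq ()
    set K := ‖q‖ * (∑ i, ‖b i‖) * ‖star b'‖ with hK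
    have hK0 : 0 ≤ K := by positivity
    obtain ⟨e, heC, f, hfC, hf0, hef, he⟩ := hloc (‖M‖ / (4 * (K + 1))) (by positivity)
    set δ := ‖M‖ / (4 * (K + 1)) with hδ
    have hr0 : g * f ≠ 0 := fun h => (hS g hgB f hfC h).elim hg0 hf0
    have heb : ‖e * b'‖ ≤ δ * ∑ i, ‖b i‖ := by
      have e1 : e * b' = - ∑ i, b i * (e * (a * p i - algebraMap ℂ A (l i))) := by
        have e2 : ∑ i, b i * (e * (a * p i)) = e * ∑ i, b i * (a * p i) := by
          rw [Finset.mul_sum]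
          refine Finset.sum_congr rfl fun i _ => ?_
          rw [← mul_assoc, hcomm _ (hb i) _ heC, mul_assoc]
        simp only [mul_sub, Finset.sum_sub_distrib, e2, hsum2, mul_zero, zero_sub, neg_neg]
        rw [hb', Finset.mul_sum]
        refine Finset.sum_congr rfl fun i _ => ?_
        rw [← mul_assoc, hcomm _ (hb i) _ heC, mul_assoc, ← Algebra.commutes, Algebra.smul_def]
      rw [e1, norm_neg, Finset.mul_sum]
      refine (norm_sum_le _ _).trans (Finset.sum_le_sum fun i _ => ?_)
      refine (norm_mul_le _ _).trans ?_
      rw [mul_comm]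
      gcongr
      exact he i
    set r := g * f with hr
    have her : e * r = r := by
      rw [hr, ← mul_assoc, ← hcomm _ hgB _ heC, mul_assoc, hef]
    have hqr : q * r = r := by rw [hr, ← mul_assoc, hqg]
    have hid : M • r = q * h * r - q * (h - algebraMap ℂ A M) * r := by
      rw [mul_sub, sub_mul, sub_sub_cancel, ← Algebra.commutes, mul_assoc, hqr, Algebra.smul_def]
    have hqh : q * h * r = q * ((e * b') * (star b' * r)) := by
      have : h * (e * r) = e * h * r := by rw [← mul_assoc, hcomm h hhB e heC]
      rw [mul_assoc]
      conv_lhs => rw [← her, this, hh]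
      simp only [mul_assoc]
    have n1 : ‖q * h * r‖ ≤ δ * K * ‖r‖ := by
      rw [hqh]
      calc ‖q * ((e * b') * (star b' * r))‖ ≤ ‖q‖ * (‖e * b'‖ * (‖star b'‖ * ‖r‖)) := by
            refine (norm_mul_le _ _).trans ?_
            gcongr
            refine (norm_mul_le _ _).trans ?_
            gcongr
            exact norm_mul_le _ _
        _ ≤ ‖q‖ * ((δ * ∑ i, ‖b i‖) * (‖star b'‖ * ‖r‖)) := by gcongr
        _ = δ * K * ‖r‖ := by rw [hK]; ring
    have n2 : ‖q * (h - algebraMap ℂ A M) * r‖ ≤ ‖M‖ / 2 * ‖r‖ :=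
      (norm_mul_le _ _).trans (by gcongr)
    have n3 : ‖M‖ * ‖r‖ ≤ δ * K * ‖r‖ + ‖M‖ / 2 * ‖r‖ := by
      rw [← norm_smul, hid]
      exact (norm_sub_le _ _).trans (add_le_add n1 n2)
    have hδK : δ * K ≤ ‖M‖ / 4 := by
      rw [hδ, div_mul_eq_mul_div, div_le_div_iff₀ (by positivity) (by norm_num)]
      nlinarith
    have hrpos : 0 < ‖r‖ := norm_pos_iff.mpr hr0
    nlinarith [mul_pos hMpos hrpos, mul_le_mul_of_nonneg_right hδK hrpos.le]

/-- **Roos's theorem (algebraic independence from Einstein causality and the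
Schlieder property):** if `B` and `C` are closed unital `*`-subalgebras of a
unital C*-algebra `A` that commute elementwise and satisfy the Schlieder
property (`b * c = 0 → b = 0 ∨ c = 0`), then for any linearly independent
`b₁, …, bₙ ∈ B` and any `c₁, …, cₙ ∈ C` with `∑ i, bᵢ * cᵢ = 0` one has all
`cᵢ = 0`; equivalently, the canonical map `B ⊗[ℂ] C → A`, `b ⊗ c ↦ b * c`, is
injective, and hence induces an algebra isomorphism of `B ⊗[ℂ] C` onto the
subalgebra of `A` generated by `B ∪ C`. -/
theorem roos_tensor_product_of_schlieder
    {A : Type*} [CStarAlgebra A]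
    (B C : StarSubalgebra ℂ A)
    (hBclosed : IsClosed (B : Set A)) (hCclosed : IsClosed (C : Set A))
    (hcomm : ∀ b ∈ B, ∀ c ∈ C, b * c = c * b)
    (hSchlieder : ∀ b ∈ B, ∀ c ∈ C, b * c = 0 → b = 0 ∨ c = 0) :
    (∀ (n : ℕ) (b : Fin n → B) (c : Fin n → C), LinearIndependent ℂ b →
        (∑ i, (b i : A) * (c i : A)) = 0 → ∀ i, c i = 0) ∧
    Function.Injective
      (Algebra.TensorProduct.lift B.subtype.toAlgHom C.subtype.toAlgHom
        (fun b c => hcomm b b.2 c c.2)) ∧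
    (Algebra.TensorProduct.lift B.subtype.toAlgHom C.subtype.toAlgHom
        (fun b c => hcomm b b.2 c c.2)).range
      = Algebra.adjoin ℂ ((B : Set A) ∪ (C : Set A)) := by
  have h1 : ∀ (n : ℕ) (b : Fin n → B) (c : Fin n → C), LinearIndependent ℂ b →
        (∑ i, (b i : A) * (c i : A)) = 0 → ∀ i, c i = 0 := by
    intro n b c hli hs i
    exact Subtype.ext (roos_main B C hBclosed hCclosed hcomm hSchlieder n
      (fun i => (b i : A)) (fun i => (c i : A)) (fun i => (b i).2) (fun i => (c i).2)
      (hli.map' B.subtype.toAlgHom.toLinearMap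
        (LinearMap.ker_eq_bot.mpr Subtype.val_injective)) hs i)
  have ht : ∀ (b : B) (c : C),
      (Algebra.TensorProduct.lift B.subtype.toAlgHom C.subtype.toAlgHom
        (fun b c => hcomm b b.2 c c.2)) (b ⊗ₜ[ℂ] c) = (b : A) * (c : A) := fun b c =>
    Algebra.TensorProduct.lift_tmul _ _ _ b c
  refine ⟨h1, ?_, ?_⟩
  · rw [injective_iff_map_eq_zero]
    intro x hx
    obtain ⟨c, rfl⟩ := TensorProduct.eq_repr_basis_left (Module.Basis.ofVectorSpace ℂ B) x
    set bs := Module.Basis.ofVectorSpace ℂ B with hbs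
    let φ := c.support.equivFin.symm
    have hs : ∑ i, ((bs (φ i : _) : B) : A) * ((c (φ i : _) : C) : A) = 0 := by
      rw [φ.sum_comp (fun k : c.support => ((bs (k : _) : B) : A) * ((c (k : _) : C) : A)),
        Finset.sum_coe_sort c.support (fun k => ((bs k : B) : A) * ((c k : C) : A))]
      rw [Finsupp.sum, map_sum] at hx
      exact (Finset.sum_congr rfl fun k _ => (ht _ _).symm).trans hx
    have := h1 _ (fun i => bs (φ i : _)) (fun i => c (φ i : _))
      (bs.linearIndependent.comp _ (Subtype.val_injective.comp φ.injective)) hs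
    refine Finset.sum_eq_zero fun k hk => ?_
    have h2 := this (φ.symm ⟨k, hk⟩)
    simp only [Equiv.apply_symm_apply] at h2
    change bs k ⊗ₜ[ℂ] c k = 0
    rw [h2, TensorProduct.tmul_zero]
  · apply le_antisymm
    · rintro _ ⟨x, rfl⟩
      induction x using TensorProduct.induction_on with
      | zero => simp
      | tmul b c =>
        have hb : (b : A) ∈ Algebra.adjoin ℂ ((B : Set A) ∪ (C : Set A)) :=
          Algebra.subset_adjoin (Or.inl b.2)
        have hc : (c : A) ∈ Algebra.adjoin ℂ ((B : Set A) ∪ (C : Set A)) :=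
          Algebra.subset_adjoin (Or.inr c.2)
        have hm := mul_mem hb hc
        rw [← ht b c] at hm
        exact hm
      | add x y hx hy =>
        simpa using add_mem hx hy
    · refine Algebra.adjoin_le ?_
      rintro x (hx | hx)
      · exact ⟨(⟨x, hx⟩ : B) ⊗ₜ[ℂ] (1 : C), (ht _ _).trans (mul_one x)⟩
      · exact ⟨(1 : B) ⊗ₜ[ℂ] (⟨x, hx⟩ : C), (ht _ _).trans (one_mul x)⟩
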